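/- Let b, c ∈ F_q[T] be distinct polynomials of positive degree, n, m, ℓ ≥ 1 integers, and a₁, …, a_{n−1} ∈ F_q[T] of positive degree. Consider the ultimately periodic continued fraction α = [0; a₁, …, a_{n−1}, c, overline{b^{[m]}, c, b^{[ℓ]}}] ∈ F_q((T⁻¹)) with convergents (p_k/q_k). Then H(α) ≍_{b,c} |q_n · q_{n+m+ℓ+1}|, i.e., there exist positive constants depending only on b, c bounding H(α)/|q_n q_{n+m+ℓ+1}| above and below. -/

import Mathlib

open Polynomial
open scoped Classical

noncomputable section

namespace CFq

variable (Fq : Type) [Field Fq] [Fintype Fq]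

/-- The element `T` of `F_q((T⁻¹))`, realized as `X⁻¹` in the Laurent series field. -/
def Tls : LaurentSeries Fq := HahnSeries.single (-1 : ℤ) (1 : Fq)

/-- The embedding of `F_q[T]` into `F_q((T⁻¹))`. -/
def toLS : Polynomial Fq →+* LaurentSeries Fq :=
  (Polynomial.aeval (Tls Fq)).toRingHom

/-- The absolute value `|ξ| = q^{-N}` where `ξ = Σ_{n ≥ N} a_n T^{-n}`, `a_N ≠ 0`. -/
def absQ (ξ : LaurentSeries Fq) : ℝ :=
  if ξ = 0 then 0 else (Fintype.card Fq : ℝ) ^ (-ξ.order)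

/-- Absolute value of a polynomial in `T`:  `|f| = q^{deg f}`. -/
def pabs (f : Polynomial Fq) : ℝ := absQ Fq (toLS Fq f)

/-- The height of a polynomial `P(X) ∈ (F_q[T])[X]`: the maximum of the absolute
values of its coefficients. -/
def Hpoly (P : Polynomial (Polynomial Fq)) : ℝ :=
  sSup {x : ℝ | ∃ i, x = pabs Fq (P.coeff i)}

/-- `ξ` has the (infinite) continued fraction expansion `[a₀; a₁, a₂, …]`, where all
partial quotients `aₙ`, `n ≥ 1`, have positive degree.  This is expressed via the
sequence of complete quotients (tails) `t n`, which satisfy `t n = a n + 1/(t (n+1))`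
and `|t n| > 1` for `n ≥ 1`. -/
def IsCF (ξ : LaurentSeries Fq) (a : ℕ → Polynomial Fq) : Prop :=
  (∀ n, 1 ≤ n → 1 ≤ (a n).natDegree) ∧
  ∃ t : ℕ → LaurentSeries Fq, t 0 = ξ ∧
    (∀ n, t n = toLS Fq (a n) + (t (n + 1))⁻¹) ∧
    (∀ n, 1 ≤ n → 1 < absQ Fq (t n))

/-- Denominators of the convergents: `q₀ = 1`, `q₁ = a₁`, `qₙ = aₙ q_{n-1} + q_{n-2}`. -/
def qden (a : ℕ → Polynomial Fq) : ℕ → Polynomial Fq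
  | 0 => 1
  | 1 => a 1
  | n + 2 => a (n + 2) * qden a (n + 1) + qden a n

/-- Evaluation of `P(X) ∈ (F_q[T])[X]` at a Laurent series. -/
def evalLS (P : Polynomial (Polynomial Fq)) (ξ : LaurentSeries Fq) : LaurentSeries Fq :=
  Polynomial.eval₂ (toLS Fq) ξ P

/-- The degree of an algebraic Laurent series over `F_q(T)`: the least degree of a
nonzero polynomial over `F_q[T]` annihilating it. -/
def degLS (ξ : LaurentSeries Fq) : ℕ :=
  sInf {d | ∃ P : Polynomial (Polynomial Fq), P ≠ 0 ∧ P.natDegree = d ∧ evalLS Fq P ξ = 0}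

/-- The height of an algebraic Laurent series: the least height of a nonzero annihilating
polynomial of minimal degree (this is the height of the primitive minimal polynomial). -/
def heightLS (ξ : LaurentSeries Fq) : ℝ :=
  sInf {x | ∃ P : Polynomial (Polynomial Fq),
    P ≠ 0 ∧ P.natDegree = degLS Fq ξ ∧ evalLS Fq P ξ = 0 ∧ x = Hpoly Fq P}

/-- The Diophantine exponent `w_n(ξ)`. -/
def wExp (n : ℕ) (ξ : LaurentSeries Fq) : EReal :=
  sSup ((fun w : ℝ => (w : EReal)) ''
    {w | {P : Polynomial (Polynomial Fq) | P.natDegree ≤ n ∧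
      0 < absQ Fq (evalLS Fq P ξ) ∧
      absQ Fq (evalLS Fq P ξ) ≤ Hpoly Fq P ^ (-w)}.Infinite})

variable (L : Type) [Field L] [Algebra (LaurentSeries Fq) L]

/-- The embedding of `F_q[T]` into a field extension `L` of `F_q((T⁻¹))`. -/
def embRing : Polynomial Fq →+* L :=
  (algebraMap (LaurentSeries Fq) L).comp (toLS Fq)

/-- Evaluation of `P(X) ∈ (F_q[T])[X]` at `α ∈ L`. -/
def evalA (P : Polynomial (Polynomial Fq)) (α : L) : L :=
  Polynomial.eval₂ (embRing Fq L) α P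

/-- The degree of an algebraic `α ∈ L` over `F_q(T)`. -/
def degA (α : L) : ℕ :=
  sInf {d | ∃ P : Polynomial (Polynomial Fq), P ≠ 0 ∧ P.natDegree = d ∧ evalA Fq L P α = 0}

/-- The height of an algebraic `α ∈ L`: the height of its primitive minimal polynomial
over `F_q[T]`. -/
def heightA (α : L) : ℝ :=
  sInf {x | ∃ P : Polynomial (Polynomial Fq),
    P ≠ 0 ∧ P.natDegree = degA Fq L α ∧ evalA Fq L P α = 0 ∧ x = Hpoly Fq P}

/-- `α ∈ L` is algebraic of degree at most `n` over `F_q(T)`. -/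
def IsAlgDeg (n : ℕ) (α : L) : Prop :=
  ∃ P : Polynomial (Polynomial Fq), P ≠ 0 ∧ P.natDegree ≤ n ∧ evalA Fq L P α = 0

/-- The Diophantine exponent `w_n^*(ξ)`, computed with respect to an extension `L` of
`F_q((T⁻¹))` (to be taken algebraically closed) endowed with an absolute value `v`
extending `absQ`. -/
def wstarExp (n : ℕ) (ξ : LaurentSeries Fq) (v : AbsoluteValue L ℝ) : EReal :=
  sSup ((fun w : ℝ => (w : EReal)) ''
    {w | {α : L | IsAlgDeg Fq L n α ∧
      0 < v (algebraMap (LaurentSeries Fq) L ξ - α) ∧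
      v (algebraMap (LaurentSeries Fq) L ξ - α) ≤ heightA Fq L α ^ (-w - 1)}.Infinite})

end CFq

end
section ContinuantMatrix

variable {R : Type*} [CommRing R]

/-- The elementary matrix of a partial quotient. -/
def cfStep (x : R) : Matrix (Fin 2) (Fin 2) R := !![x, 1; 1, 0]

/-- The matrix with rows `(p_k, p_{k-1})` and `(q_k, q_{k-1})` of the continued fraction with
partial quotients `a`. -/
def cfMat (a : ℕ → R) : ℕ → Matrix (Fin 2) (Fin 2) R
  | 0 => cfStep (a 0)
  | k + 1 => cfMat a k * cfStep (a (k + 1))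

lemma cfMat_succ_apply_zero (a : ℕ → R) (k : ℕ) (i : Fin 2) :
    cfMat a (k + 1) i 0 = cfMat a k i 0 * a (k + 1) + cfMat a k i 1 := by
  simp [cfMat, cfStep, Matrix.mul_apply, Fin.sum_univ_two]

lemma cfMat_succ_apply_one (a : ℕ → R) (k : ℕ) (i : Fin 2) :
    cfMat a (k + 1) i 1 = cfMat a k i 0 := by
  simp [cfMat, cfStep, Matrix.mul_apply, Fin.sum_univ_two]

lemma isUnit_cfStep (x : R) : IsUnit (cfStep x) := by
  rw [Matrix.isUnit_iff_isUnit_det]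
  simp [cfStep, Matrix.det_fin_two_of]

lemma isUnit_cfMat (a : ℕ → R) (k : ℕ) : IsUnit (cfMat a k) := by
  induction k with
  | zero => exact isUnit_cfStep _
  | succ k ih => exact ih.mul (isUnit_cfStep _)

lemma cfMat_map {S : Type*} [CommRing S] (φ : R →+* S) (a : ℕ → R) (k : ℕ) (i j : Fin 2) :
    cfMat (fun r => φ (a r)) k i j = φ (cfMat a k i j) := by
  induction k generalizing i j with
  | zero => fin_cases i <;> fin_cases j <;> simp [cfMat, cfStep]
  | succ k ih =>
    fin_cases j
    · simp [cfMat_succ_apply_zero, ih]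
    · simp [cfMat_succ_apply_one, ih]

lemma cfMat_add_of_const (a : ℕ → R) (n k : ℕ) (b : R)
    (h : ∀ j < k, a (n + 1 + j) = b) : cfMat a (n + k) = cfMat a n * cfStep b ^ k := by
  induction k with
  | zero => simp
  | succ k ih =>
    rw [← add_assoc, cfMat, ih fun j hj => h j (by omega), pow_succ, ← mul_assoc,
      show n + k + 1 = n + 1 + k by ring, h k (by omega)]

lemma cfMat_block (a : ℕ → R) (n m l : ℕ) (b c : R)
    (h₁ : ∀ j < m, a (n + 1 + j) = b) (h₂ : a (n + m + 1) = c)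
    (h₃ : ∀ j < l, a (n + m + 1 + 1 + j) = b) :
    cfMat a (n + m + l + 1) = cfMat a n * (cfStep b ^ m * cfStep c * cfStep b ^ l) := by
  rw [show n + m + l + 1 = n + m + 1 + l by ring, cfMat_add_of_const a _ l b h₃, cfMat,
    cfMat_add_of_const a n m b h₁, h₂]
  simp only [mul_assoc]

lemma eq_of_commute_cfStep {b c : R} (h : Commute (cfStep c) (cfStep b)) : b = c := by
  have := congrFun (congrFun h.eq 1) 0
  simpa [cfStep, Matrix.mul_apply, Fin.sum_univ_two] using this

lemma eq_of_commute_block {b c : R} {m l : ℕ}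
    (h : Commute (cfStep b ^ m * cfStep c * cfStep b ^ l) (cfStep b)) : b = c := by
  refine eq_of_commute_cfStep ?_
  have hu := isUnit_cfStep b
  refine (hu.pow m).mul_left_cancel ((hu.pow l).mul_right_cancel ?_)
  have h₁ := (Commute.refl (cfStep b)).pow_left m
  have h₂ := (Commute.refl (cfStep b)).pow_left l
  calc cfStep b ^ m * (cfStep c * cfStep b) * cfStep b ^ l
      = cfStep b ^ m * cfStep c * (cfStep b * cfStep b ^ l) := by simp only [mul_assoc]
    _ = cfStep b ^ m * cfStep c * cfStep b ^ l * cfStep b := by rw [← h₂.eq]; simp only [mul_assoc]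
    _ = cfStep b * (cfStep b ^ m * cfStep c * cfStep b ^ l) := h.eq
    _ = cfStep b * cfStep b ^ m * cfStep c * cfStep b ^ l := by simp only [mul_assoc]
    _ = cfStep b ^ m * (cfStep b * cfStep c) * cfStep b ^ l := by
        rw [← h₁.eq]; simp only [mul_assoc]

/-- The leading coefficient of the quadratic form fixed by `N * M⁻¹`. -/
def quadA (M N : Matrix (Fin 2) (Fin 2) R) : R := N 1 0 * M 1 1 - M 1 0 * N 1 1

/-- The middle coefficient of the quadratic form fixed by `N * M⁻¹`. -/
def quadB (M N : Matrix (Fin 2) (Fin 2) R) : R :=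
  M 1 0 * N 0 1 + M 0 0 * N 1 1 - N 1 0 * M 0 1 - N 0 0 * M 1 1

/-- The constant coefficient of the quadratic form fixed by `N * M⁻¹`. -/
def quadC (M N : Matrix (Fin 2) (Fin 2) R) : R := N 0 0 * M 0 1 - M 0 0 * N 0 1

lemma commute_of_quad_eq_zero {M S : Matrix (Fin 2) (Fin 2) R} (hM : IsUnit M)
    (hA : quadA M (M * S) = 0) (hB : quadB M (M * S) = 0) (hC : quadC M (M * S) = 0)
    (X : Matrix (Fin 2) (Fin 2) R) : Commute S X := by
  have hd : IsUnit M.det := (Matrix.isUnit_iff_isUnit_det M).1 hM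
  have hN : M * S * M.adjugate
      = Matrix.scalar (Fin 2) ((M * S * M.adjugate) 1 1) := by
    simp only [quadA, quadB, quadC] at hA hB hC
    ext i j
    generalize M * S = N at *
    fin_cases i <;> fin_cases j <;>
      simp [Matrix.mul_apply, Fin.sum_univ_two, Matrix.adjugate_fin_two]
    · linear_combination -hB
    · linear_combination -hC
    · linear_combination hA
  have hS : M.det • S = Matrix.scalar (Fin 2) ((M * S * M.adjugate) 1 1) := by
    refine hM.mul_left_cancel ?_
    rw [← (Matrix.scalar_commute _ (fun _ => Commute.all _ _) M).eq, ← hN, mul_assoc _ _ M,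
      Matrix.adjugate_mul]
    simp
  have h : Commute (M.det • S) X := by
    rw [hS]
    exact Matrix.scalar_commute _ (fun _ => Commute.all _ _) X
  have h' := h.eq
  rw [Matrix.smul_mul, Matrix.mul_smul] at h'
  exact hd.smul_left_cancel.1 h'

/-- The content of the quadratic form of a period `b^[m], c, b^[l]` divides `b - c`. -/
lemma sub_mem_span_quad (a : ℕ → R) (n m l : ℕ) (b c : R)
    (h₁ : ∀ j < m, a (n + 1 + j) = b) (h₂ : a (n + m + 1) = c)
    (h₃ : ∀ j < l, a (n + m + 1 + 1 + j) = b) :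
    b - c ∈ Ideal.span {quadA (cfMat a n) (cfMat a (n + m + l + 1)),
      quadB (cfMat a n) (cfMat a (n + m + l + 1)),
      quadC (cfMat a n) (cfMat a (n + m + l + 1))} := by
  set I := Ideal.span {quadA (cfMat a n) (cfMat a (n + m + l + 1)),
      quadB (cfMat a n) (cfMat a (n + m + l + 1)),
      quadC (cfMat a n) (cfMat a (n + m + l + 1))} with hI
  set φ := Ideal.Quotient.mk I
  have hA : φ (quadA (cfMat a n) (cfMat a (n + m + l + 1))) = 0 :=
    Ideal.Quotient.eq_zero_iff_mem.2 (Ideal.subset_span (by simp))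
  have hB : φ (quadB (cfMat a n) (cfMat a (n + m + l + 1))) = 0 :=
    Ideal.Quotient.eq_zero_iff_mem.2 (Ideal.subset_span (by simp))
  have hC : φ (quadC (cfMat a n) (cfMat a (n + m + l + 1))) = 0 :=
    Ideal.Quotient.eq_zero_iff_mem.2 (Ideal.subset_span (by simp))
  have hblock := cfMat_block (fun r => φ (a r)) n m l (φ b) (φ c)
    (fun j hj => by simp only [h₁ j hj]) (by simp only [h₂]) (fun j hj => by simp only [h₃ j hj])
  rw [← Ideal.Quotient.eq_zero_iff_mem, map_sub, sub_eq_zero]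
  refine eq_of_commute_block (m := m) (l := l)
    (commute_of_quad_eq_zero (isUnit_cfMat (fun r => φ (a r)) n) ?_ ?_ ?_ _)
  · rw [← hblock, ← hA]; simp [quadA, cfMat_map]
  · rw [← hblock, ← hB]; simp [quadB, cfMat_map]
  · rw [← hblock, ← hC]; simp [quadC, cfMat_map]

/-- If `α = M · t = N · t` as Möbius transformations, then `α` is a root of the form of
`N * M⁻¹`. -/
lemma quad_eval_eq_zero {K : Type*} [Field K] {M N : Matrix (Fin 2) (Fin 2) K} {α t : K}
    (ht : t ≠ 0) (hM : α * (M 1 0 * t + M 1 1) = M 0 0 * t + M 0 1)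
    (hN : α * (N 1 0 * t + N 1 1) = N 0 0 * t + N 0 1) :
    quadA M N * α ^ 2 + quadB M N * α + quadC M N = 0 := by
  refine (mul_eq_zero.1 ?_).resolve_left ht
  simp only [quadA, quadB, quadC]
  linear_combination (N 0 1 - α * N 1 1) * hM - (M 0 1 - α * M 1 1) * hN

/-- `α = M_k · t_{k+1}` for the complete quotients `t` of `α`. -/
lemma cfMat_mobius {K : Type*} [Field K] (a t : ℕ → K) (ht : ∀ n, t n = a n + (t (n + 1))⁻¹)
    (h₀ : ∀ n, 1 ≤ n → t n ≠ 0) (k : ℕ) :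
    t 0 * (cfMat a k 1 0 * t (k + 1) + cfMat a k 1 1)
      = cfMat a k 0 0 * t (k + 1) + cfMat a k 0 1 := by
  induction k with
  | zero =>
    have h := h₀ 1 le_rfl
    rw [ht 0]
    simp only [cfMat, cfStep]
    simp
    field_simp
  | succ k ih =>
    have h := h₀ (k + 1 + 1) (by omega)
    rw [ht (k + 1)] at ih
    simp only [cfMat_succ_apply_zero, cfMat_succ_apply_one]
    field_simp at ih
    linear_combination ih

end ContinuantMatrix

section NonarchimedeanValue

variable {R : Type*} [CommRing R] {v : AbsoluteValue R ℝ}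

lemma val_sub_le (hv : IsNonarchimedean v) {x y : R} {r : ℝ} (hx : v x ≤ r) (hy : v y ≤ r) :
    v (x - y) ≤ r := by
  rw [sub_eq_add_neg]
  exact (hv _ _).trans (max_le hx (by rwa [v.map_neg]))

lemma quad_val_le (hv : IsNonarchimedean v) {M N : Matrix (Fin 2) (Fin 2) R} {r s : ℝ}
    (hM : ∀ i j, v (M i j) ≤ r) (hN : ∀ i j, v (N i j) ≤ s) :
    v (quadA M N) ≤ r * s ∧ v (quadB M N) ≤ r * s ∧ v (quadC M N) ≤ r * s := by
  have hr : 0 ≤ r := (v.nonneg _).trans (hM 0 0)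
  have hMN : ∀ i j k l, v (M i j * N k l) ≤ r * s := fun i j k l => by
    rw [map_mul]
    exact mul_le_mul (hM i j) (hN k l) (v.nonneg _) hr
  have hNM : ∀ i j k l, v (N i j * M k l) ≤ r * s := fun i j k l => by
    rw [mul_comm]
    exact hMN k l i j
  exact ⟨val_sub_le hv (hNM ..) (hMN ..),
    val_sub_le hv (val_sub_le hv ((hv _ _).trans (max_le (hMN ..) (hMN ..))) (hNM ..)) (hNM ..),
    val_sub_le hv (hNM ..) (hMN ..)⟩

variable [IsDomain R]

lemma cfMat_row_lt (hv : IsNonarchimedean v) {a : ℕ → R} (ha : ∀ i, 1 ≤ i → 1 < v (a i))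
    (k : ℕ) : v (cfMat a k 1 1) < v (cfMat a k 1 0) := by
  induction k with
  | zero => simp [cfMat, cfStep]
  | succ k ih =>
    have hpos : 0 < v (cfMat a k 1 0) := (v.nonneg _).trans_lt ih
    have h : v (cfMat a k 1 0) < v (cfMat a k 1 0 * a (k + 1)) := by
      rw [map_mul]
      exact lt_mul_of_one_lt_right hpos (ha _ (by omega))
    rw [cfMat_succ_apply_zero, cfMat_succ_apply_one,
      hv.add_eq_left_of_lt (ih.trans h)]
    exact h

lemma cfMat_succ_apply_one_zero_val (hv : IsNonarchimedean v) {a : ℕ → R}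
    (ha : ∀ i, 1 ≤ i → 1 < v (a i)) (k : ℕ) :
    v (cfMat a (k + 1) 1 0) = v (cfMat a k 1 0) * v (a (k + 1)) := by
  have hlt := cfMat_row_lt hv ha k
  have h : v (cfMat a k 1 0) < v (cfMat a k 1 0 * a (k + 1)) := by
    rw [map_mul]
    exact lt_mul_of_one_lt_right ((v.nonneg _).trans_lt hlt) (ha _ (by omega))
  rw [cfMat_succ_apply_zero, hv.add_eq_left_of_lt (hlt.trans h), map_mul]

lemma cfMat_entry_le (hv : IsNonarchimedean v) {a : ℕ → R}
    (ha : ∀ i, 1 ≤ i → 1 < v (a i)) (h₀ : a 0 = 0) (k : ℕ) (i j : Fin 2) :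
    v (cfMat a k i j) ≤ v (cfMat a k 1 0) := by
  induction k generalizing i j with
  | zero => fin_cases i <;> fin_cases j <;> simp [cfMat, cfStep, h₀]
  | succ k ih =>
    have h1 := (ha (k + 1) (by omega)).le
    have hle : v (cfMat a k 1 0) ≤ v (cfMat a k 1 0) * v (a (k + 1)) :=
      le_mul_of_one_le_right (v.nonneg _) h1
    rw [cfMat_succ_apply_one_zero_val hv ha]
    fin_cases j
    · change v (cfMat a (k + 1) i 0) ≤ _
      rw [cfMat_succ_apply_zero]
      refine (hv _ _).trans (max_le ?_ ((ih i 1).trans hle))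
      rw [map_mul]
      exact mul_le_mul_of_nonneg_right (ih i 0) (v.nonneg _)
    · change v (cfMat a (k + 1) i 1) ≤ _
      rw [cfMat_succ_apply_one]
      exact (ih i 0).trans hle

/-- The leading coefficient is as large as possible when the last partial quotients differ. -/
lemma val_quadA (hv : IsNonarchimedean v) {a : ℕ → R}
    (ha : ∀ i, 1 ≤ i → 1 < v (a i)) (j k : ℕ)
    (hjk : 1 ≤ v (a (k + 1) - a (j + 1))) :
    v (quadA (cfMat a (j + 1)) (cfMat a (k + 1))) * (v (a (j + 1)) * v (a (k + 1)))
      = v (a (k + 1) - a (j + 1)) * (v (cfMat a (j + 1) 1 0) * v (cfMat a (k + 1) 1 0)) := by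
  have hj := cfMat_row_lt hv ha j
  have hk := cfMat_row_lt hv ha k
  have hj0 : 0 < v (cfMat a j 1 0) := (v.nonneg _).trans_lt hj
  have hk0 : 0 < v (cfMat a k 1 0) := (v.nonneg _).trans_lt hk
  have hA : quadA (cfMat a (j + 1)) (cfMat a (k + 1))
      = (a (k + 1) - a (j + 1)) * (cfMat a j 1 0 * cfMat a k 1 0)
        + (cfMat a k 1 1 * cfMat a j 1 0 + -(cfMat a j 1 1 * cfMat a k 1 0)) := by
    simp only [quadA, cfMat_succ_apply_zero, cfMat_succ_apply_one]
    ring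
  have hlt : v (cfMat a k 1 1 * cfMat a j 1 0 + -(cfMat a j 1 1 * cfMat a k 1 0))
      < v ((a (k + 1) - a (j + 1)) * (cfMat a j 1 0 * cfMat a k 1 0)) := by
    rw [map_mul v (a (k + 1) - a (j + 1)), map_mul]
    refine lt_of_lt_of_le ?_ (le_mul_of_one_le_left (by positivity) hjk)
    refine (hv _ _).trans_lt (max_lt ?_ ?_)
    · rw [map_mul, mul_comm]
      exact mul_lt_mul_of_pos_left hk hj0
    · rw [v.map_neg, map_mul]
      exact mul_lt_mul_of_pos_right hj hk0
  rw [hA, hv.add_eq_left_of_lt hlt, cfMat_succ_apply_one_zero_val hv ha,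
    cfMat_succ_apply_one_zero_val hv ha, map_mul, map_mul]
  ring

end NonarchimedeanValue

namespace CFq

variable (Fq : Type) [Field Fq]

lemma cfMat_qden (a : ℕ → Polynomial Fq) (k : ℕ) :
    cfMat a k 1 0 = qden Fq a k ∧ cfMat a (k + 1) 1 0 = qden Fq a (k + 1) := by
  induction k with
  | zero => simp [qden, cfMat, cfStep]
  | succ k ih =>
    refine ⟨ih.2, ?_⟩
    rw [cfMat_succ_apply_zero, cfMat_succ_apply_one, ih.1, ih.2, qden, mul_comm]

lemma toLS_X : toLS Fq X = Tls Fq := by simp [toLS]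

lemma toLS_C (r : Fq) : toLS Fq (C r) = HahnSeries.C r := by
  simp only [toLS, AlgHom.toRingHom_eq_coe, RingHom.coe_coe, aeval_C]
  rw [HahnSeries.algebraMap_apply', PowerSeries.algebraMap_apply, Algebra.algebraMap_self_apply,
    HahnSeries.ofPowerSeries_C]

lemma evalLS_quadratic (A B D : Polynomial Fq) (ξ : LaurentSeries Fq) :
    evalLS Fq (C A * X ^ 2 + C B * X + C D) ξ
      = toLS Fq A * ξ ^ 2 + toLS Fq B * ξ + toLS Fq D := by
  simp [evalLS]

lemma evalLS_linear (B D : Polynomial Fq) (ξ : LaurentSeries Fq) :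
    evalLS Fq (C B * X + C D) ξ = toLS Fq B * ξ + toLS Fq D := by
  simp [evalLS]

variable [Fintype Fq]

lemma one_lt_card_real : (1 : ℝ) < Fintype.card Fq := by
  exact_mod_cast Fintype.one_lt_card

/-- `absQ` as an absolute value. -/
noncomputable def absV : AbsoluteValue (LaurentSeries Fq) ℝ where
  toFun := absQ Fq
  map_mul' x y := by
    have hq := (zero_lt_one.trans (one_lt_card_real Fq)).ne'
    by_cases hx : x = 0
    · simp [absQ, hx]
    by_cases hy : y = 0
    · simp [absQ, hy]
    simp only [absQ, hx, hy, mul_eq_zero, or_self, if_false]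
    rw [HahnSeries.order_mul hx hy, neg_add, zpow_add₀ hq]
  nonneg' x := by
    unfold absQ
    split_ifs <;> positivity
  eq_zero' x := by
    have hq := (zero_lt_one.trans (one_lt_card_real Fq)).ne'
    unfold absQ
    split_ifs with h
    · simp [h]
    · simp [h, zpow_ne_zero _ hq]
  add_le' x y := by
    have hq := one_lt_card_real Fq
    have hn : ∀ z, 0 ≤ absQ Fq z := fun z => by unfold absQ; split_ifs <;> positivity
    by_cases hx : x = 0
    · simp [absQ, hx]
    by_cases hy : y = 0
    · simp [absQ, hy]
    by_cases hxy : x + y = 0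
    · rw [hxy]
      simpa [absQ] using add_nonneg (hn x) (hn y)
    have h := HahnSeries.min_order_le_order_add hxy
    rcases min_le_iff.1 h with h | h
    · refine le_add_of_le_of_nonneg ?_ (hn y)
      simp only [absQ, hx, hxy, if_false]
      exact zpow_le_zpow_right₀ hq.le (by omega)
    · refine le_add_of_nonneg_of_le (hn x) ?_
      simp only [absQ, hy, hxy, if_false]
      exact zpow_le_zpow_right₀ hq.le (by omega)

lemma absV_apply (x : LaurentSeries Fq) : absV Fq x = absQ Fq x := rfl

lemma absV_of_ne_zero {x : LaurentSeries Fq} (hx : x ≠ 0) :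
    absV Fq x = (Fintype.card Fq : ℝ) ^ (-x.order) := by
  simp [absV_apply, absQ, hx]

lemma absV_isNonarchimedean : IsNonarchimedean (absV Fq) := by
  intro x y
  have hq := one_lt_card_real Fq
  by_cases hx : x = 0
  · simp [hx]
  by_cases hy : y = 0
  · simp [hy]
  by_cases hxy : x + y = 0
  · simp [hxy]
  rw [absV_of_ne_zero Fq hx, absV_of_ne_zero Fq hy, absV_of_ne_zero Fq hxy, le_max_iff]
  rcases min_le_iff.1 (HahnSeries.min_order_le_order_add hxy) with h | h
  · exact Or.inl (zpow_le_zpow_right₀ hq.le (by omega))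
  · exact Or.inr (zpow_le_zpow_right₀ hq.le (by omega))

lemma two_le_absV {x : LaurentSeries Fq} (h : 1 < absV Fq x) : 2 ≤ absV Fq x := by
  have hx : x ≠ 0 := by
    rintro rfl
    simp at h
    linarith
  rw [absV_of_ne_zero Fq hx] at h ⊢
  have h₁ : 0 < -x.order := by
    rwa [← zpow_zero (Fintype.card Fq : ℝ), zpow_lt_zpow_iff_right₀ (one_lt_card_real Fq)] at h
  calc (2 : ℝ) ≤ (Fintype.card Fq : ℝ) ^ (1 : ℤ) := by
        rw [zpow_one]
        exact_mod_cast Fintype.one_lt_card (α := Fq)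
    _ ≤ _ := zpow_le_zpow_right₀ (one_lt_card_real Fq).le (by omega)

lemma absV_Tls : absV Fq (Tls Fq) = Fintype.card Fq := by
  have h : Tls Fq ≠ 0 := HahnSeries.single_ne_zero one_ne_zero
  rw [absV_of_ne_zero Fq h, Tls, HahnSeries.order_single one_ne_zero]
  simp

lemma absV_toLS_C {r : Fq} (hr : r ≠ 0) : absV Fq (toLS Fq (C r)) = 1 := by
  have h : toLS Fq (C r) ≠ 0 := by
    rw [toLS_C]
    exact HahnSeries.C_ne_zero hr
  rw [absV_of_ne_zero Fq h, toLS_C, HahnSeries.order_C]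
  simp

lemma absV_toLS_C_le (r : Fq) : absV Fq (toLS Fq (C r)) ≤ 1 := by
  by_cases hr : r = 0
  · simp [hr]
  · exact (absV_toLS_C Fq hr).le

lemma pabs_eq_pow {f : Polynomial Fq} (hf : f ≠ 0) :
    pabs Fq f = (Fintype.card Fq : ℝ) ^ f.natDegree := by
  have hq := one_lt_card_real Fq
  change absV Fq (toLS Fq f) = _
  induction hd : f.natDegree generalizing f with
  | zero =>
    obtain ⟨r, rfl⟩ := natDegree_eq_zero.1 hd
    rw [absV_toLS_C Fq (by simpa using hf), pow_zero]
  | succ d ih =>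
    have hdd : f.divX.natDegree = d := by rw [natDegree_divX_eq_natDegree_tsub_one, hd]; rfl
    have hd0 : f.divX ≠ 0 := fun h => by
      rw [divX_eq_zero_iff] at h
      rw [h, natDegree_C] at hd
      omega
    have hX : absV Fq (toLS Fq (f.divX * X)) = (Fintype.card Fq : ℝ) ^ (d + 1) := by
      rw [map_mul, map_mul, ih hd0 hdd, toLS_X, absV_Tls, pow_succ]
    rw [← divX_mul_X_add f, map_add, (absV_isNonarchimedean Fq).add_eq_left_of_lt, hX]
    rw [hX]
    exact (absV_toLS_C_le Fq _).trans_lt (one_lt_pow₀ hq (by omega))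

/-- `pabs` as an absolute value. -/
noncomputable def pabsV : AbsoluteValue (Polynomial Fq) ℝ where
  toFun := pabs Fq
  map_mul' x y := by simp only [pabs, ← absV_apply, map_mul]
  nonneg' x := (absV Fq).nonneg _
  eq_zero' x := by
    have hq := (zero_lt_one.trans (one_lt_card_real Fq)).ne'
    refine ⟨fun h => ?_, fun h => by simp [h, pabs, absQ]⟩
    by_contra hx
    rw [pabs_eq_pow Fq hx] at h
    exact pow_ne_zero _ hq h
  add_le' x y := by
    simp only [pabs, ← absV_apply, map_add]
    exact (absV Fq).add_le _ _

lemma pabsV_apply (f : Polynomial Fq) : pabsV Fq f = pabs Fq f := rfl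

lemma pabsV_eq_absV (f : Polynomial Fq) : pabsV Fq f = absV Fq (toLS Fq f) := rfl

lemma pabsV_isNonarchimedean : IsNonarchimedean (pabsV Fq) := fun x y => by
  simp only [pabsV_eq_absV, map_add]
  exact absV_isNonarchimedean Fq _ _

lemma toLS_eq_zero {f : Polynomial Fq} : toLS Fq f = 0 ↔ f = 0 := by
  rw [← (absV Fq).eq_zero, ← pabsV_eq_absV, (pabsV Fq).eq_zero]

lemma one_le_pabsV {f : Polynomial Fq} (hf : f ≠ 0) : 1 ≤ pabsV Fq f := by
  rw [pabsV_apply, pabs_eq_pow Fq hf]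
  exact one_le_pow₀ (one_lt_card_real Fq).le

lemma one_lt_pabsV {f : Polynomial Fq} (hf : 1 ≤ f.natDegree) : 1 < pabsV Fq f := by
  have h : f ≠ 0 := by
    rintro rfl
    simp at hf
  rw [pabsV_apply, pabs_eq_pow Fq h]
  exact one_lt_pow₀ (one_lt_card_real Fq) (by omega)

lemma natDegree_lt_of_pabsV_lt {f g : Polynomial Fq} (hf : f ≠ 0) (hg : g ≠ 0)
    (h : pabsV Fq f < pabsV Fq g) : f.natDegree < g.natDegree := by
  rw [pabsV_apply, pabsV_apply, pabs_eq_pow Fq hf, pabs_eq_pow Fq hg] at h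
  exact (pow_lt_pow_iff_right₀ (one_lt_card_real Fq)).1 h

section CompleteQuotients

variable {Fq} {a : ℕ → Polynomial Fq} {t : ℕ → LaurentSeries Fq}

lemma ne_zero_of_one_lt_absV {x : LaurentSeries Fq} (h : 1 < absV Fq x) : x ≠ 0 := by
  rintro rfl
  rw [map_zero] at h
  linarith

lemma eq_zero_of_mul_completeQuotient (ht : ∀ n, t n = toLS Fq (a n) + (t (n + 1))⁻¹)
    (h₁ : ∀ n, 1 ≤ n → 1 < absV Fq (t n)) (n : ℕ) {x y : Polynomial Fq}
    (h : toLS Fq y * t n = toLS Fq x) : y = 0 := by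
  induction hd : y.natDegree using Nat.strong_induction_on generalizing n x y with
  | _ d ih =>
    by_contra hy
    have h1 := h₁ (n + 1) (by omega)
    have h0 := ne_zero_of_one_lt_absV h1
    have hr : toLS Fq (x - a n * y) * t (n + 1) = toLS Fq y := by
      rw [ht n] at h
      rw [map_sub, map_mul, ← h]
      field_simp
      ring
    have hr0 : x - a n * y ≠ 0 := by
      intro h'
      rw [h', map_zero, zero_mul] at hr
      exact hy ((toLS_eq_zero Fq).1 hr.symm)
    have hlt : pabsV Fq (x - a n * y) < pabsV Fq y := by
      rw [pabsV_eq_absV Fq y, ← hr, map_mul, ← pabsV_eq_absV]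
      exact lt_mul_of_one_lt_right ((pabsV Fq).pos hr0) h1
    exact hr0 (ih _ (hd ▸ natDegree_lt_of_pabsV_lt Fq hr0 hy hlt) (n + 1) hr rfl)

/-- Complete quotients are determined by the partial quotients. -/
lemma completeQuotient_eq {a' : ℕ → Polynomial Fq} {t' : ℕ → LaurentSeries Fq}
    (ht : ∀ n, t n = toLS Fq (a n) + (t (n + 1))⁻¹) (h₁ : ∀ n, 1 < absV Fq (t n))
    (ht' : ∀ n, t' n = toLS Fq (a' n) + (t' (n + 1))⁻¹) (h₁' : ∀ n, 1 < absV Fq (t' n))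
    (haa : ∀ n, a n = a' n) (k : ℕ) : t k = t' k := by
  have hstep : ∀ k, t k - t' k = (t' (k + 1) - t (k + 1)) / (t (k + 1) * t' (k + 1)) := by
    intro k
    have h := ne_zero_of_one_lt_absV (h₁ (k + 1))
    have h' := ne_zero_of_one_lt_absV (h₁' (k + 1))
    rw [ht k, ht' k, haa k]
    field_simp
    ring
  have hval : ∀ k, absV Fq (t k - t' k) * (absV Fq (t (k + 1)) * absV Fq (t' (k + 1)))
      = absV Fq (t (k + 1) - t' (k + 1)) := by
    intro k
    have h := ne_zero_of_one_lt_absV (h₁ (k + 1))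
    have h' := ne_zero_of_one_lt_absV (h₁' (k + 1))
    rw [← map_mul, ← map_mul, hstep k, div_mul_cancel₀ _ (mul_ne_zero h h'), (absV Fq).map_sub]
  have hle : ∀ k, absV Fq (t k - t' k) ≤ 1 := by
    intro k
    have e : t k - t' k = (t (k + 1))⁻¹ - (t' (k + 1))⁻¹ := by
      rw [ht k, ht' k, haa k]
      ring
    rw [e]
    refine val_sub_le (absV_isNonarchimedean Fq) ?_ ?_ <;> rw [map_inv₀]
    · exact inv_le_one_of_one_le₀ (h₁ _).le
    · exact inv_le_one_of_one_le₀ (h₁' _).le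
  have hpow : ∀ j k, absV Fq (t k - t' k) * 2 ^ j ≤ 1 := by
    intro j
    induction j with
    | zero => simpa using hle
    | succ j ih =>
      intro k
      refine le_trans ?_ (ih (k + 1))
      rw [← hval k, pow_succ', ← mul_assoc]
      refine mul_le_mul_of_nonneg_right (mul_le_mul_of_nonneg_left ?_ ((absV Fq).nonneg _))
        (by positivity)
      have := two_le_absV Fq (h₁ (k + 1))
      have := h₁' (k + 1)
      nlinarith
  by_contra hne
  have hpos : 0 < absV Fq (t k - t' k) := (absV Fq).pos (sub_ne_zero.2 hne)
  obtain ⟨j, hj⟩ := pow_unbounded_of_one_lt (absV Fq (t k - t' k))⁻¹ one_lt_two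
  have := hpow j k
  rw [inv_lt_iff_one_lt_mul₀' hpos] at hj
  linarith

end CompleteQuotients

section Height

variable {Fq}

lemma Hpoly_bddAbove (P : Polynomial (Polynomial Fq)) :
    BddAbove {x : ℝ | ∃ i, x = pabs Fq (P.coeff i)} := by
  refine ⟨∑ i ∈ P.support, pabsV Fq (P.coeff i), ?_⟩
  rintro _ ⟨i, rfl⟩
  rw [← pabsV_apply]
  by_cases hi : i ∈ P.support
  · exact Finset.single_le_sum (f := fun i => pabsV Fq (P.coeff i))
      (fun j _ => (pabsV Fq).nonneg _) hi
  · rw [notMem_support_iff.1 hi, map_zero]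
    exact Finset.sum_nonneg fun j _ => (pabsV Fq).nonneg _

lemma pabsV_coeff_le_Hpoly (P : Polynomial (Polynomial Fq)) (i : ℕ) :
    pabsV Fq (P.coeff i) ≤ Hpoly Fq P :=
  le_csSup (Hpoly_bddAbove P) ⟨i, rfl⟩

lemma Hpoly_le {P : Polynomial (Polynomial Fq)} {r : ℝ} (h : ∀ i, pabsV Fq (P.coeff i) ≤ r) :
    Hpoly Fq P ≤ r := by
  refine csSup_le ⟨_, 0, rfl⟩ ?_
  rintro _ ⟨i, rfl⟩
  exact h i

/-- The height of a quadratic irrational, compared with that of an annihilating polynomial whose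
content divides `δ`. -/
lemma heightLS_bounds_of_quadratic {α : LaurentSeries Fq} {A B D δ : Polynomial Fq} {r : ℝ}
    (hirr : ∀ x y, toLS Fq y * α = toLS Fq x → y = 0) (hA0 : A ≠ 0)
    (h : toLS Fq A * α ^ 2 + toLS Fq B * α + toLS Fq D = 0)
    (hδ : δ ∈ Ideal.span {A, B, D}) (hδ0 : δ ≠ 0)
    (hA : pabsV Fq A ≤ r) (hB : pabsV Fq B ≤ r) (hD : pabsV Fq D ≤ r) :
    pabsV Fq A ≤ pabsV Fq δ * heightLS Fq α ∧ heightLS Fq α ≤ r := by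
  have hlin : ∀ x y, toLS Fq y * α + toLS Fq x = 0 → y = 0 ∧ x = 0 := by
    intro x y hxy
    have hy : y = 0 := hirr (-x) y (by rw [map_neg]; linear_combination hxy)
    rw [hy, map_zero, zero_mul, zero_add] at hxy
    exact ⟨hy, (toLS_eq_zero Fq).1 hxy⟩
  set Q : Polynomial (Polynomial Fq) := C A * X ^ 2 + C B * X + C D with hQ
  have hQd : Q.natDegree = 2 := natDegree_quadratic hA0
  have hQ0 : Q ≠ 0 := ne_zero_of_natDegree_gt (n := 0) (by omega)
  have hQe : evalLS Fq Q α = 0 := by rw [hQ, evalLS_quadratic, h]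
  have hdeg : degLS Fq α = 2 := by
    refine le_antisymm (Nat.sInf_le ⟨Q, hQ0, hQd, hQe⟩)
      (le_csInf ⟨2, Q, hQ0, hQd, hQe⟩ ?_)
    rintro _ ⟨P, hP0, rfl, hPe⟩
    by_contra hlt
    obtain ⟨y, x, rfl⟩ := exists_eq_X_add_C_of_natDegree_le_one (p := P) (by omega)
    rw [evalLS_linear] at hPe
    obtain ⟨rfl, rfl⟩ := hlin x y hPe
    simp at hP0
  have hbdd : BddBelow {x | ∃ P : Polynomial (Polynomial Fq),
      P ≠ 0 ∧ P.natDegree = degLS Fq α ∧ evalLS Fq P α = 0 ∧ x = Hpoly Fq P} := by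
    refine ⟨0, ?_⟩
    rintro _ ⟨P, -, -, -, rfl⟩
    exact ((pabsV Fq).nonneg _).trans (pabsV_coeff_le_Hpoly P 0)
  have hδpos : 0 < pabsV Fq δ := (pabsV Fq).pos hδ0
  constructor
  · rw [← div_le_iff₀' hδpos]
    refine le_csInf ⟨_, Q, hQ0, hQd.trans hdeg.symm, hQe, rfl⟩ ?_
    rintro _ ⟨P, hP0, hPd, hPe, rfl⟩
    rw [hdeg] at hPd
    have hP : P = C (P.coeff 2) * X ^ 2 + C (P.coeff 1) * X + C (P.coeff 0) :=
      eq_quadratic_of_degree_le_two (natDegree_le_iff_degree_le.1 hPd.le)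
    have hP2 : P.coeff 2 ≠ 0 := by
      rw [← hPd]
      exact leadingCoeff_ne_zero.2 hP0
    rw [hP, evalLS_quadratic] at hPe
    obtain ⟨e₁, e₀⟩ := hlin (P.coeff 2 * D - A * P.coeff 0) (P.coeff 2 * B - A * P.coeff 1) (by
      simp only [map_sub, map_mul]
      linear_combination toLS Fq (P.coeff 2) * h - toLS Fq A * hPe)
    obtain ⟨u, z, hz, hu⟩ := Ideal.mem_span_insert.1 hδ
    obtain ⟨w, s, rfl⟩ := Ideal.mem_span_pair.1 hz
    have hdvd : P.coeff 2 * δ = A * (u * P.coeff 2 + w * P.coeff 1 + s * P.coeff 0) := by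
      rw [hu]
      linear_combination w * e₁ + s * e₀
    have hne : u * P.coeff 2 + w * P.coeff 1 + s * P.coeff 0 ≠ 0 := fun h0 => by
      rw [h0, mul_zero] at hdvd
      exact mul_ne_zero hP2 hδ0 hdvd
    rw [div_le_iff₀ hδpos]
    calc pabsV Fq A ≤ pabsV Fq A * pabsV Fq (u * P.coeff 2 + w * P.coeff 1 + s * P.coeff 0) :=
          le_mul_of_one_le_right ((pabsV Fq).nonneg _) (one_le_pabsV Fq hne)
      _ = pabsV Fq (P.coeff 2) * pabsV Fq δ := by rw [← map_mul, ← hdvd, map_mul]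
      _ ≤ _ := mul_le_mul_of_nonneg_right (pabsV_coeff_le_Hpoly P 2) hδpos.le
  · refine (csInf_le hbdd ⟨Q, hQ0, hQd.trans hdeg.symm, hQe, rfl⟩).trans (Hpoly_le fun i => ?_)
    have hr : 0 ≤ r := ((pabsV Fq).nonneg _).trans hA
    rcases i with _ | _ | _ | i
    · simpa [hQ] using hD
    · simpa [hQ, coeff_X, coeff_C] using hB
    · simpa [hQ, coeff_X, coeff_C] using hA
    · rw [coeff_eq_zero_of_natDegree_lt (by omega), map_zero]
      exact hr

lemma heightLS_bounds_of_block {a : ℕ → Polynomial Fq} {α : LaurentSeries Fq}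
    {b c : Polynomial Fq} (hbc : b ≠ c) {n m l : ℕ} (hn : 1 ≤ n) (hl : 1 ≤ l)
    (hα : IsCF Fq α a) (h₀ : a 0 = 0) (hc : a n = c) (h₁ : ∀ j < m, a (n + 1 + j) = b)
    (h₂ : a (n + m + 1) = c) (h₃ : ∀ j < l, a (n + m + 1 + 1 + j) = b)
    (hper : ∀ i, a (n + 1 + i) = a (n + m + l + 1 + 1 + i)) :
    pabsV Fq (qden Fq a n * qden Fq a (n + m + l + 1))
        ≤ pabsV Fq b * pabsV Fq c * heightLS Fq α ∧
      heightLS Fq α ≤ pabsV Fq (qden Fq a n * qden Fq a (n + m + l + 1)) := by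
  obtain ⟨hdeg, t, rfl, ht, htl⟩ := hα
  have hv := pabsV_isNonarchimedean Fq
  have ha : ∀ i, 1 ≤ i → 1 < pabsV Fq (a i) := fun i hi => one_lt_pabsV Fq (hdeg i hi)
  have hb : a (n + m + l + 1) = b := by
    have := h₃ (l - 1) (by omega)
    rwa [show n + m + 1 + 1 + (l - 1) = n + m + l + 1 by omega] at this
  have hδ := one_le_pabsV Fq (sub_ne_zero.2 hbc)
  have hb1 : 1 < pabsV Fq b := hb ▸ ha _ (by omega)
  have hc1 : 1 < pabsV Fq c := hc ▸ ha _ hn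
  have htail : t (n + 1) = t (n + m + l + 1 + 1) :=
    completeQuotient_eq (a := fun i => a (n + 1 + i)) (t := fun i => t (n + 1 + i))
      (a' := fun i => a (n + m + l + 1 + 1 + i)) (t' := fun i => t (n + m + l + 1 + 1 + i))
      (fun i => ht _) (fun i => htl _ (by omega)) (fun i => ht _) (fun i => htl _ (by omega))
      hper 0
  have hmob := cfMat_mobius (fun i => toLS Fq (a i)) t ht
    (fun i hi => ne_zero_of_one_lt_absV (htl i hi))
  have hroot := quad_eval_eq_zero (ne_zero_of_one_lt_absV (htl (n + 1) (by omega)))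
    (hmob n) (htail ▸ hmob (n + m + l + 1))
  have hroot' : toLS Fq (quadA (cfMat a n) (cfMat a (n + m + l + 1))) * t 0 ^ 2
      + toLS Fq (quadB (cfMat a n) (cfMat a (n + m + l + 1))) * t 0
      + toLS Fq (quadC (cfMat a n) (cfMat a (n + m + l + 1))) = 0 := by
    rw [← hroot]
    simp [quadA, quadB, quadC, cfMat_map]
  have hval : pabsV Fq (quadA (cfMat a n) (cfMat a (n + m + l + 1)))
        * (pabsV Fq c * pabsV Fq b)
      = pabsV Fq (b - c) * pabsV Fq (qden Fq a n * qden Fq a (n + m + l + 1)) := by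
    obtain ⟨j, rfl⟩ : ∃ j, n = j + 1 := ⟨n - 1, by omega⟩
    have := val_quadA hv ha j (j + 1 + m + l) (by rw [hb, hc]; exact hδ)
    rw [map_mul (pabsV Fq) (qden Fq a (j + 1))]
    rwa [hb, hc, (cfMat_qden Fq a _).1, (cfMat_qden Fq a _).1] at this
  obtain ⟨hA, hB, hC⟩ := quad_val_le hv (cfMat_entry_le hv ha h₀ n)
    (cfMat_entry_le hv ha h₀ (n + m + l + 1))
  rw [(cfMat_qden Fq a _).1, (cfMat_qden Fq a _).1, ← map_mul] at hA hB hC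
  have hq0 : ∀ k, 0 < pabsV Fq (qden Fq a k) := fun k => by
    rw [← (cfMat_qden Fq a k).1]
    exact ((pabsV Fq).nonneg _).trans_lt (cfMat_row_lt hv ha k)
  have hA0 : quadA (cfMat a n) (cfMat a (n + m + l + 1)) ≠ 0 := fun h => by
    rw [h, map_zero, zero_mul, map_mul] at hval
    have := mul_pos (zero_lt_one.trans_le hδ) (mul_pos (hq0 n) (hq0 (n + m + l + 1)))
    linarith
  obtain ⟨hlow, hup⟩ := heightLS_bounds_of_quadratic
    (fun x y h => eq_zero_of_mul_completeQuotient ht htl 0 h) hA0 hroot'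
    (sub_mem_span_quad a n m l b c h₁ h₂ h₃) (sub_ne_zero.2 hbc) hA hB hC
  refine ⟨le_of_mul_le_mul_left ?_ (zero_lt_one.trans_le hδ), hup⟩
  rw [← hval]
  have := mul_le_mul_of_nonneg_right hlow
    (mul_pos (zero_lt_one.trans hc1) (zero_lt_one.trans hb1)).le
  linarith

end Height

end CFq

/-- for `α = [0; a₁, …, a_{n−1}, c, overline{b^{[m]}, c, b^{[ℓ]}}]`,
`H(α) ≍_{b,c} |q_n q_{n+m+ℓ+1}|`, with implied constants depending only on `b, c`. -/
theorem stmt18 (Fq : Type) [Field Fq] [Fintype Fq]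
    (b c : Polynomial Fq) (hb : 1 ≤ b.natDegree) (hc : 1 ≤ c.natDegree) (hbc : b ≠ c) :
    ∃ C₁ C₂ : ℝ, 0 < C₁ ∧ 0 < C₂ ∧
      ∀ (n m l : ℕ), 1 ≤ n → 1 ≤ m → 1 ≤ l →
        ∀ (a : ℕ → Polynomial Fq), (∀ i, 1 ≤ i → i ≤ n - 1 → 1 ≤ (a i).natDegree) →
          ∀ (α : LaurentSeries Fq),
            CFq.IsCF Fq α (fun i =>
              if i = 0 then 0
              else if i < n then a i
              else if i = n then c
              else if (i - n - 1) % (m + l + 1) = m then c else b) →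
            C₁ * CFq.pabs Fq
                (CFq.qden Fq (fun i =>
                  if i = 0 then 0
                  else if i < n then a i
                  else if i = n then c
                  else if (i - n - 1) % (m + l + 1) = m then c else b) n *
                 CFq.qden Fq (fun i =>
                  if i = 0 then 0
                  else if i < n then a i
                  else if i = n then c
                  else if (i - n - 1) % (m + l + 1) = m then c else b) (n + m + l + 1))
              ≤ CFq.heightLS Fq α ∧
            CFq.heightLS Fq α ≤
              C₂ * CFq.pabs Fq
                (CFq.qden Fq (fun i =>
                  if i = 0 then 0
                  else if i < n then a i
                  else if i = n then c
                  else if (i - n - 1) % (m + l + 1) = m then c else b) n *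
                 CFq.qden Fq (fun i =>
                  if i = 0 then 0
                  else if i < n then a i
                  else if i = n then c
                  else if (i - n - 1) % (m + l + 1) = m then c else b) (n + m + l + 1)) := by
  have hb1 := zero_lt_one.trans (CFq.one_lt_pabsV Fq hb)
  have hc1 := zero_lt_one.trans (CFq.one_lt_pabsV Fq hc)
  refine ⟨(CFq.pabsV Fq b * CFq.pabsV Fq c)⁻¹, 1, by positivity, one_pos, ?_⟩
  intro n m l hn hm hl a _ α hα
  rw [one_mul, inv_mul_le_iff₀ (by positivity)]
  refine CFq.heightLS_bounds_of_block hbc hn hl hα (by simp) ?_ ?_ ?_ ?_ ?_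
  · simp [show n ≠ 0 by omega]
  · intro j hj
    have e : (n + 1 + j - n - 1) % (m + l + 1) = j := by
      rw [show n + 1 + j - n - 1 = j by omega, Nat.mod_eq_of_lt (by omega)]
    simp only [e]
    split_ifs <;> first | rfl | omega
  · have e : (n + m + 1 - n - 1) % (m + l + 1) = m := by
      rw [show n + m + 1 - n - 1 = m by omega, Nat.mod_eq_of_lt (by omega)]
    simp only [if_pos e]
    rw [if_neg (by omega), if_neg (by omega), ite_self]
  · intro j hj
    have e : (n + m + 1 + 1 + j - n - 1) % (m + l + 1) = m + 1 + j := by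
      rw [show n + m + 1 + 1 + j - n - 1 = m + 1 + j by omega, Nat.mod_eq_of_lt (by omega)]
    simp only [e]
    split_ifs <;> first | rfl | omega
  · intro i
    have e : (n + m + l + 1 + 1 + i - n - 1) % (m + l + 1)
        = (n + 1 + i - n - 1) % (m + l + 1) := by
      rw [show n + m + l + 1 + 1 + i - n - 1 = n + 1 + i - n - 1 + (m + l + 1) by omega,
        Nat.add_mod_right]
    simp only [e]
    split_ifs <;> first | rfl | omega
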